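/- For every finite connected simple port-labeled graph G with n vertices, every root vertex v_R, and every integer k with 2 ≤ k ≤ n, the k-stopped port-DFS traversal halts at the vertex v_L (the k-th vertex added to S), and v_L is a leaf of the tree T of parent edges, i.e., v_L has degree 1 in T. -/

import Mathlib

open scoped Classical

/-- Direction of a move of the port-DFS traversal. -/
inductive PDir : Type where
  | fwd : PDir
  | bwd : PDir
deriving DecidableEq

/-- Position of the port-DFS walk: before the first move (`start`, at the root),
having just arrived at `cur` via in-port `inPort` with direction `dir` (`moving`),
or halted at a vertex. -/
inductive PPos (V : Type) : Type where
  | start : PPos V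
  | moving : V → ℕ → PDir → PPos V
  | halted : V → PPos V

/-- Full state of the port-DFS traversal: position, set `S` of visited vertices,
and parent-port assignment `par`. -/
structure PState (V : Type) : Type where
  pos : PPos V
  vis : Finset V
  par : V → ℕ

/-- A finite connected simple port-labeled graph: for every vertex `u` of degree
`deg u`, the edges incident to `u` are labeled by distinct ports `0, …, deg u - 1`;
`port u v` is the port at `u` of the edge `{u, v}`. -/
structure PortedGraph (V : Type) [Fintype V] [DecidableEq V] : Type where
  G : SimpleGraph V
  conn : G.Connected
  deg : V → ℕ
  port : V → V → ℕ
  port_lt : ∀ {u v : V}, G.Adj u v → port u v < deg u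
  port_inj : ∀ {u v w : V}, G.Adj u v → G.Adj u w → port u v = port u w → v = w
  port_surj : ∀ {u : V} (p : ℕ), p < deg u → ∃ v : V, G.Adj u v ∧ port u v = p

namespace PortedGraph

variable {V : Type} [Fintype V] [DecidableEq V]

/-- The neighbor of `u` reached from `u` through port `p`. -/
noncomputable def dest (P : PortedGraph V) (u : V) (p : ℕ) : V :=
  if h : ∃ v : V, P.G.Adj u v ∧ P.port u v = p then h.choose else u

/-- One step of the port-DFS traversal from root `vR`.  A state with
`pos = moving v q d` means the walk has just arrived at `v` via port `q` (at `v`)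
with direction `d`, and `vis`/`par` are the data from before processing this
arrival; the step processes the arrival according to rules (i)–(v) and performs
the next move (or halts). -/
noncomputable def step (P : PortedGraph V) (vR : V) (s : PState V) : PState V :=
  match s.pos with
  | PPos.start =>
      if 0 < P.deg vR then
        { pos := PPos.moving (P.dest vR 0) (P.port (P.dest vR 0) vR) PDir.fwd,
          vis := s.vis, par := s.par }
      else
        { pos := PPos.halted vR, vis := s.vis, par := s.par }
  | PPos.halted v => { pos := PPos.halted v, vis := s.vis, par := s.par }
  | PPos.moving v q PDir.fwd =>
      if v ∈ s.vis then
        -- rule (ii): leave via `q` with direction backward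
        { pos := PPos.moving (P.dest v q) (P.port (P.dest v q) v) PDir.bwd,
          vis := s.vis, par := s.par }
      else
        -- rule (i): add `v` to `S`, set `par v := q`, leave via `(q+1) % deg v`
        { pos := PPos.moving (P.dest v ((q + 1) % P.deg v))
            (P.port (P.dest v ((q + 1) % P.deg v)) v)
            (if (q + 1) % P.deg v = q then PDir.bwd else PDir.fwd),
          vis := insert v s.vis, par := Function.update s.par v q }
  | PPos.moving v q PDir.bwd =>
      if v ≠ vR ∧ (q + 1) % P.deg v = s.par v then
        -- rule (iii): leave via the parent port with direction backward
        { pos := PPos.moving (P.dest v (s.par v)) (P.port (P.dest v (s.par v)) v) PDir.bwd,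
          vis := s.vis, par := s.par }
      else if v = vR ∧ (q + 1) % P.deg v = 0 then
        -- rule (iv): halt
        { pos := PPos.halted v, vis := s.vis, par := s.par }
      else
        -- rule (v): leave via `(q+1) % deg v` with direction forward
        { pos := PPos.moving (P.dest v ((q + 1) % P.deg v))
            (P.port (P.dest v ((q + 1) % P.deg v)) v) PDir.fwd,
          vis := s.vis, par := s.par }

/-- The trace of the port-DFS traversal from `vR`:  `trace P vR t` is the state
after `t` transitions; every transition except those into/out of a halted
position is a move along an edge. -/
noncomputable def trace (P : PortedGraph V) (vR : V) : ℕ → PState V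
  | 0 => { pos := PPos.start, vis := {vR}, par := fun _ => 0 }
  | t + 1 => P.step vR (P.trace vR t)

/-- The first time at which `k` distinct vertices have been visited; the
`k`-stopped traversal is the traversal halted at that moment (at which point the
walk, having made `stopTime - 1` moves, stands at the `k`-th visited vertex). -/
noncomputable def stopTime (P : PortedGraph V) (vR : V) (k : ℕ) : ℕ :=
  sInf {t : ℕ | k ≤ ((P.trace vR t).vis).card}

/-- `V'`: the set of vertices visited by the `k`-stopped traversal. -/
noncomputable def visitedBy (P : PortedGraph V) (vR : V) (k : ℕ) : Finset V :=
  (P.trace vR (P.stopTime vR k)).vis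

/-- `V'` as a set. -/
noncomputable def Vset (P : PortedGraph V) (vR : V) (k : ℕ) : Set V :=
  ↑(P.visitedBy vR k)

/-- The parent-port assignment at the end of the `k`-stopped traversal. -/
noncomputable def parFinal (P : PortedGraph V) (vR : V) (k : ℕ) : V → ℕ :=
  (P.trace vR (P.stopTime vR k)).par

/-- `u(v)`: the neighbor of `v` reached from `v` through its parent port. -/
noncomputable def parentVert (P : PortedGraph V) (vR : V) (k : ℕ) (v : V) : V :=
  P.dest v (P.parFinal vR k v)

/-- `v_L`: the `k`-th (last) vertex added to `S` by the `k`-stopped traversal. -/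
noncomputable def lastVert (P : PortedGraph V) (vR : V) (k : ℕ) : V :=
  if h : ∃ v : V, v ∈ P.visitedBy vR k ∧ v ∉ (P.trace vR (P.stopTime vR k - 1)).vis
  then h.choose else vR

/-- The tree `T` of parent edges `{v, u(v)}`, `v ∈ V' \ {v_R}`, as a graph on `V`
(vertices outside `V'` are isolated). -/
noncomputable def treeRel (P : PortedGraph V) (vR : V) (k : ℕ) : SimpleGraph V :=
  SimpleGraph.fromRel (fun a b =>
    a ∈ P.visitedBy vR k ∧ a ≠ vR ∧ b = P.parentVert vR k a)

/-- The tree `T` of parent edges as a graph on the vertex set `V'`. -/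
noncomputable def treeSub (P : PortedGraph V) (vR : V) (k : ℕ) :
    SimpleGraph (P.Vset vR k) :=
  SimpleGraph.fromRel (fun a b => (a : V) ≠ vR ∧ (b : V) = P.parentVert vR k (a : V))

/-- `v` lies on the rootpath: the unique path in `T` from `v_R` to `v_L`. -/
def onRootpath (P : PortedGraph V) (vR : V) (k : ℕ) (v : V) : Prop :=
  ∃ p : (P.treeRel vR k).Walk vR (P.lastVert vR k), p.IsPath ∧ v ∈ p.support

/-- The move made out of state `s`:  `some (v, p, d)` if the walk leaves vertex
`v` via port `p` with direction `d`, and `none` if it halts (or already halted). -/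
noncomputable def exitEvent (P : PortedGraph V) (vR : V) (s : PState V) :
    Option (V × ℕ × PDir) :=
  match s.pos with
  | PPos.start => if 0 < P.deg vR then some (vR, 0, PDir.fwd) else none
  | PPos.halted _ => none
  | PPos.moving v q PDir.fwd =>
      if v ∈ s.vis then some (v, q, PDir.bwd)
      else some (v, (q + 1) % P.deg v,
        if (q + 1) % P.deg v = q then PDir.bwd else PDir.fwd)
  | PPos.moving v q PDir.bwd =>
      if v ≠ vR ∧ (q + 1) % P.deg v = s.par v then some (v, s.par v, PDir.bwd)
      else if v = vR ∧ (q + 1) % P.deg v = 0 then none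
      else some (v, (q + 1) % P.deg v, PDir.fwd)

end PortedGraph

namespace PortedGraph

variable {V : Type} [Fintype V] [DecidableEq V] (P : PortedGraph V) {vR : V}

theorem adj_dest {u : V} {p : ℕ} (hp : p < P.deg u) : P.G.Adj u (P.dest u p) := by
  have h := P.port_surj p hp
  rw [dest, dif_pos h]
  exact h.choose_spec.1

theorem port_dest {u : V} {p : ℕ} (hp : p < P.deg u) : P.port u (P.dest u p) = p := by
  have h := P.port_surj p hp
  rw [dest, dif_pos h]
  exact h.choose_spec.2

theorem dest_port {u v : V} (h : P.G.Adj u v) : P.dest u (P.port u v) = v :=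
  P.port_inj (P.adj_dest (P.port_lt h)) h (P.port_dest (P.port_lt h))

theorem port_dest_lt {u : V} {p : ℕ} (hp : p < P.deg u) :
    P.port (P.dest u p) u < P.deg (P.dest u p) :=
  P.port_lt (P.adj_dest hp).symm

theorem dest_port_dest {u : V} {p : ℕ} (hp : p < P.deg u) :
    P.dest (P.dest u p) (P.port (P.dest u p) u) = u :=
  P.dest_port (P.adj_dest hp).symm

/-! ### Exploration of the whole graph -/

/-- `s'` is reached from `s` by finitely many transitions. -/
def Reach (P : PortedGraph V) (vR : V) (s s' : PState V) : Prop :=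
  ∃ m : ℕ, (P.step vR)^[m] s = s'

theorem Reach.trans {P : PortedGraph V} {s s' s'' : PState V}
    (h : P.Reach vR s s') (h' : P.Reach vR s' s'') : P.Reach vR s s'' := by
  obtain ⟨m, rfl⟩ := h
  obtain ⟨m', rfl⟩ := h'
  exact ⟨m' + m, Function.iterate_add_apply _ _ _ _⟩

theorem reach_step (s : PState V) : P.Reach vR s (P.step vR s) := ⟨1, rfl⟩

/-- `s'` has visited everything `s` has, with the same parent ports, and every vertex
visited in `s'` but not in `s` has all its neighbors visited in `s'`. -/
structure Extends (P : PortedGraph V) (s s' : PState V) : Prop where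
  vis_subset : s.vis ⊆ s'.vis
  par_eq : ∀ x ∈ s.vis, s'.par x = s.par x
  closed : ∀ x ∈ s'.vis, x ∉ s.vis → ∀ y, P.G.Adj x y → y ∈ s'.vis

theorem Extends.of_eq {s s' : PState V} (hv : s'.vis = s.vis) (hp : s'.par = s.par) :
    P.Extends s s' :=
  ⟨hv ▸ subset_rfl, fun _ _ => by rw [hp], fun _ hx hx' => absurd (hv ▸ hx) hx'⟩

theorem Extends.trans {P : PortedGraph V} {s s' s'' : PState V}
    (h : P.Extends s s') (h' : P.Extends s' s'') : P.Extends s s'' where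
  vis_subset := h.vis_subset.trans h'.vis_subset
  par_eq x hx := (h'.par_eq x (h.vis_subset hx)).trans (h.par_eq x hx)
  closed x hx hxs y hxy := by
    by_cases hx' : x ∈ s'.vis
    · exact h'.vis_subset (h.closed x hx' hxs y hxy)
    · exact h'.closed x hx hx' y hxy

/-- Every traversal of an edge `{v, w}` out of a visited vertex `v`, started with at most `n`
unvisited vertices, eventually comes back to `v` through the same edge. -/
def Returns (P : PortedGraph V) (vR : V) (n : ℕ) : Prop :=
  ∀ (s : PState V) (v w : V), s.visᶜ.card ≤ n → vR ∈ s.vis → v ∈ s.vis → P.G.Adj v w →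
    s.pos = PPos.moving w (P.port w v) PDir.fwd →
    ∃ s' : PState V, P.Reach vR s s' ∧ s'.pos = PPos.moving v (P.port v w) PDir.bwd ∧
      P.Extends s s' ∧ w ∈ s'.vis

theorem step_bwd_of_ne {s : PState V} {v : V} {q b : ℕ}
    (hb : (v ≠ vR ∧ s.par v = b) ∨ (v = vR ∧ b = 0)) (hne : (q + 1) % P.deg v ≠ b)
    (hpos : s.pos = PPos.moving v q PDir.bwd) :
    P.step vR s =
      { pos := PPos.moving (P.dest v ((q + 1) % P.deg v))
          (P.port (P.dest v ((q + 1) % P.deg v)) v) PDir.fwd,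
        vis := s.vis, par := s.par } := by
  rcases hb with ⟨h1, rfl⟩ | ⟨rfl, rfl⟩ <;> simp_all [step]

/-- The walk, coming back to `v`, tries the `j` ports that follow cyclically until the one
before the stopping port `b`. -/
theorem Returns.sweep {P : PortedGraph V} {n : ℕ} (hret : P.Returns vR n) {v : V} {b : ℕ} :
    ∀ (j : ℕ) (s : PState V) (q : ℕ), s.visᶜ.card ≤ n → vR ∈ s.vis → v ∈ s.vis →
      ((v ≠ vR ∧ s.par v = b) ∨ (v = vR ∧ b = 0)) → j < P.deg v →
      (q + 1 + j) % P.deg v = b → s.pos = PPos.moving v q PDir.bwd →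
      ∃ (s' : PState V) (q' : ℕ), P.Reach vR s s' ∧ s'.pos = PPos.moving v q' PDir.bwd ∧
        (q' + 1) % P.deg v = b ∧ P.Extends s s' ∧
        ∀ i < j, P.dest v ((q + 1 + i) % P.deg v) ∈ s'.vis := by
  intro j
  induction j with
  | zero =>
    intro s q _ _ _ _ _ hq hpos
    exact ⟨s, q, ⟨0, rfl⟩, hpos, hq, .of_eq P rfl rfl, by simp⟩
  | succ j ih =>
    intro s q hn hR hv hb hj hq hpos
    have hne : (q + 1) % P.deg v ≠ b := by
      intro h
      have h2 : (q + 1) ≡ (q + 1) + (j + 1) [MOD P.deg v] := h.trans hq.symm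
      have h3 := (Nat.modEq_iff_dvd' (by omega)).1 h2
      rw [Nat.add_sub_cancel_left] at h3
      exact absurd (Nat.le_of_dvd (by omega) h3) (by omega)
    have hstep := P.step_bwd_of_ne hb hne hpos
    have hp : (q + 1) % P.deg v < P.deg v := Nat.mod_lt _ (by omega)
    obtain ⟨s₁, hr₁, hpos₁, he₁, hw₁⟩ := hret (P.step vR s) v (P.dest v ((q + 1) % P.deg v))
      (by rwa [hstep]) (by rwa [hstep]) (by rwa [hstep]) (P.adj_dest hp) (by rw [hstep])
    have he₀ : P.Extends s s₁ := (Extends.of_eq P (by rw [hstep]) (by rw [hstep])).trans he₁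
    rw [P.port_dest hp] at hpos₁
    obtain ⟨s₂, q₂, hr₂, hpos₂, hq₂, he₂, hall⟩ := ih s₁ ((q + 1) % P.deg v)
      ((Finset.card_le_card (Finset.compl_subset_compl.2 he₀.vis_subset)).trans hn)
      (he₀.vis_subset hR) (he₀.vis_subset hv)
      (hb.imp_left fun h => ⟨h.1, (he₀.par_eq v hv).trans h.2⟩) (by omega)
      (by rw [← hq, add_assoc, Nat.mod_add_mod]; congr 1; omega) hpos₁
    refine ⟨s₂, q₂, ((P.reach_step s).trans hr₁).trans hr₂, hpos₂, hq₂, he₀.trans he₂, ?_⟩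
    rintro (_ | i) hi
    · exact he₂.vis_subset hw₁
    · have := hall i (by omega)
      rw [add_assoc, Nat.mod_add_mod] at this
      convert this using 3
      omega

theorem mem_of_forall_dest {S : Finset V} {v : V} {b : ℕ} (hb : b < P.deg v)
    (hbS : P.dest v b ∈ S)
    (h : ∀ i < P.deg v - 1, P.dest v ((b + 1 + i) % P.deg v) ∈ S) {y : V}
    (hy : P.G.Adj v y) : y ∈ S := by
  have hlt := P.port_lt hy
  rw [← P.dest_port hy]
  generalize P.port v y = p at hlt ⊢
  rcases lt_trichotomy p b with hpb | rfl | hpb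
  · have := h (p + P.deg v - b - 1) (by omega)
    rwa [show b + 1 + (p + P.deg v - b - 1) = p + P.deg v by omega, Nat.add_mod_right,
      Nat.mod_eq_of_lt hlt] at this
  · exact hbS
  · have := h (p - b - 1) (by omega)
    rwa [show b + 1 + (p - b - 1) = p by omega, Nat.mod_eq_of_lt hlt] at this

theorem exists_reach_of_mem {s : PState V} {v w : V} (hw : w ∈ s.vis) (hvw : P.G.Adj v w)
    (hpos : s.pos = PPos.moving w (P.port w v) PDir.fwd) :
    ∃ s' : PState V, P.Reach vR s s' ∧ s'.pos = PPos.moving v (P.port v w) PDir.bwd ∧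
      P.Extends s s' ∧ w ∈ s'.vis := by
  have hstep : P.step vR s =
      { pos := PPos.moving v (P.port v w) PDir.bwd, vis := s.vis, par := s.par } := by
    simp [step, hpos, hw, P.dest_port hvw.symm]
  exact ⟨_, P.reach_step s, by rw [hstep], .of_eq P (by rw [hstep]) (by rw [hstep]),
    by rwa [hstep]⟩

theorem returns (n : ℕ) : P.Returns vR n := by
  induction n with
  | zero =>
    intro s v w hn hR hv hvw hpos
    have hw : w ∈ s.vis := by
      by_contra hw
      have : w ∈ s.visᶜ := Finset.mem_compl.2 hw
      simp_all
    exact P.exists_reach_of_mem hw hvw hpos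
  | succ n ih =>
    intro s v w hn hR hv hvw hpos
    by_cases hw : w ∈ s.vis
    · exact P.exists_reach_of_mem hw hvw hpos
    have hq := P.port_lt hvw.symm
    have hd := P.dest_port hvw.symm
    set q := P.port w v
    have hwR : w ≠ vR := by rintro rfl; exact hw hR
    -- arriving at the new vertex `w` acts like coming back to `w` through its parent port
    let s₁ : PState V :=
      { pos := PPos.moving w q PDir.bwd, vis := insert w s.vis,
        par := Function.update s.par w q }
    have hstep₁ : P.step vR s = P.step vR s₁ := by
      by_cases h : (q + 1) % P.deg w = q <;> simp [step, hpos, hw, hwR, s₁, h]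
    obtain ⟨s₂, q₂, ⟨m, hm⟩, hpos₂, hq₂, he₂, hall⟩ := ih.sweep (v := w) (b := q)
      (P.deg w - 1) s₁ q (by
        have : s₁.visᶜ ⊂ s.visᶜ := Finset.compl_ssubset_compl.2 (Finset.ssubset_insert hw)
        have := Finset.card_lt_card this
        omega) (Finset.mem_insert_of_mem hR) (Finset.mem_insert_self _ _)
      (Or.inl ⟨hwR, by simp [s₁]⟩) (by omega)
      (by rw [show q + 1 + (P.deg w - 1) = q + P.deg w by omega, Nat.add_mod_right,
        Nat.mod_eq_of_lt hq]) rfl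
    have hpar : s₂.par w = q := by
      rw [he₂.par_eq w (Finset.mem_insert_self _ _)]; simp [s₁]
    have hstep₂ : P.step vR s₂ =
        { pos := PPos.moving v (P.port v w) PDir.bwd, vis := s₂.vis, par := s₂.par } := by
      simp [step, hpos₂, hwR, hq₂, hpar, hd]
    have hsub : s.vis ⊆ s₂.vis := (Finset.subset_insert w s.vis).trans he₂.vis_subset
    have hw₂ : w ∈ s₂.vis := he₂.vis_subset (Finset.mem_insert_self _ _)
    refine ⟨P.step vR s₂, ⟨m + 1, ?_⟩, by rw [hstep₂], ?_, by rwa [hstep₂]⟩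
    · rw [Function.iterate_succ_apply, hstep₁, ← Function.iterate_succ_apply,
        Function.iterate_succ_apply', hm]
    · refine Extends.trans (s' := s₂) ⟨hsub, ?_, ?_⟩
        (.of_eq P (by rw [hstep₂]) (by rw [hstep₂]))
      · intro x hx
        have hxw : x ≠ w := by rintro rfl; exact hw hx
        rw [he₂.par_eq x (Finset.mem_insert_of_mem hx)]
        simp [s₁, hxw]
      · intro x hx hxs y hxy
        by_cases hxw : x = w
        · subst hxw
          exact P.mem_of_forall_dest hq (hd ▸ hsub hv) hall hxy
        · exact he₂.closed x hx (by simp [s₁, hxw, hxs]) y hxy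

theorem trace_eq_iterate (t : ℕ) : P.trace vR t = (P.step vR)^[t] (P.trace vR 0) := by
  induction t with
  | zero => rfl
  | succ t ih => rw [Function.iterate_succ_apply', ← ih]; rfl

theorem eq_univ_of_closed {S : Finset V} (hR : vR ∈ S)
    (h : ∀ x ∈ S, ∀ y, P.G.Adj x y → y ∈ S) : S = Finset.univ := by
  refine Finset.eq_univ_iff_forall.2 fun y => ?_
  obtain ⟨p⟩ := P.conn.preconnected vR y
  induction p with
  | nil => exact hR
  | cons hadj _ ih => exact ih (h _ hR _ hadj)

/-- The traversal eventually visits every vertex. -/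
theorem exists_trace_vis_eq_univ (vR : V) : ∃ t, (P.trace vR t).vis = Finset.univ := by
  by_cases hdeg : 0 < P.deg vR
  · have hadj := P.adj_dest hdeg
    obtain ⟨s₁, hr₁, hpos₁, he₁, hw₁⟩ := P.returns (vR := vR) _ (P.trace vR 1) vR (P.dest vR 0)
      le_rfl (by simp [trace, step, hdeg]) (by simp [trace, step, hdeg]) hadj
      (by simp [trace, step, hdeg])
    rw [P.port_dest hdeg] at hpos₁
    have hvis : (P.trace vR 1).vis = {vR} := by simp [trace, step, hdeg]
    have hR₁ : vR ∈ s₁.vis := he₁.vis_subset (by simp [hvis])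
    obtain ⟨s₂, q₂, hr₂, -, -, he₂, hall⟩ := (P.returns (vR := vR) _).sweep (v := vR) (b := 0)
      (P.deg vR - 1) s₁ 0 le_rfl hR₁ hR₁ (Or.inr ⟨rfl, rfl⟩) (by omega)
      (by rw [show 0 + 1 + (P.deg vR - 1) = P.deg vR by omega, Nat.mod_self]) hpos₁
    obtain ⟨m, hm⟩ := ((P.reach_step (vR := vR) (P.trace vR 0)).trans hr₁).trans hr₂
    have he := he₁.trans he₂
    refine ⟨m, ?_⟩
    rw [P.trace_eq_iterate, hm]
    refine P.eq_univ_of_closed (he₂.vis_subset hR₁) fun x hx y hxy => ?_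
    by_cases hxR : x = vR
    · subst hxR
      exact P.mem_of_forall_dest hdeg (he₂.vis_subset hw₁) hall hxy
    · exact he.closed x hx (by simp [hvis, hxR]) y hxy
  · refine ⟨0, P.eq_univ_of_closed (vR := vR) (by simp [trace]) fun x hx y hxy => ?_⟩
    obtain rfl : x = vR := by simpa [trace] using hx
    have := P.port_lt hxy
    omega

/-! ### Invariants of the traversal -/

/-- Invariant of the position: the in-port is a genuine port, a forward move comes from a
visited vertex and a backward move arrives at a visited vertex. -/
def PosInv (P : PortedGraph V) (S : Finset V) : PPos V → Prop
  | PPos.start => True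
  | PPos.halted _ => True
  | PPos.moving v q PDir.fwd => q < P.deg v ∧ P.dest v q ∈ S
  | PPos.moving v q PDir.bwd => q < P.deg v ∧ v ∈ S

/-- Invariant of the traversal: parent ports are genuine and lead to visited vertices. -/
structure Inv (P : PortedGraph V) (vR : V) (s : PState V) : Prop where
  root_mem : vR ∈ s.vis
  par_lt : ∀ x ∈ s.vis, x ≠ vR → s.par x < P.deg x
  parent_mem : ∀ x ∈ s.vis, x ≠ vR → P.dest x (s.par x) ∈ s.vis
  pos : P.PosInv s.vis s.pos

theorem posInv_fwd {S : Finset V} {v : V} {p : ℕ} (hp : p < P.deg v) (hv : v ∈ S) :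
    P.PosInv S (PPos.moving (P.dest v p) (P.port (P.dest v p) v) PDir.fwd) :=
  ⟨P.port_dest_lt hp, by rwa [P.dest_port_dest hp]⟩

theorem posInv_bwd {S : Finset V} {v : V} {p : ℕ} (hp : p < P.deg v) (hv : P.dest v p ∈ S) :
    P.PosInv S (PPos.moving (P.dest v p) (P.port (P.dest v p) v) PDir.bwd) :=
  ⟨P.port_dest_lt hp, hv⟩

theorem Inv.step {P : PortedGraph V} {s : PState V} (h : P.Inv vR s) :
    P.Inv vR (P.step vR s) := by
  obtain ⟨pos, vis, par⟩ := s
  obtain ⟨hR, hlt, hpar, hpos⟩ := h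
  dsimp only at hR hlt hpar hpos
  match pos, hpos with
  | PPos.start, _ =>
    by_cases hd : 0 < P.deg vR
    · simp only [PortedGraph.step, if_pos hd]
      exact ⟨hR, hlt, hpar, P.posInv_fwd hd hR⟩
    · simp only [PortedGraph.step, if_neg hd]
      exact ⟨hR, hlt, hpar, trivial⟩
  | PPos.halted v, _ => exact ⟨hR, hlt, hpar, trivial⟩
  | PPos.moving v q PDir.fwd, ⟨hq, hm⟩ =>
    by_cases hv : v ∈ vis
    · simp only [PortedGraph.step, if_pos hv]
      exact ⟨hR, hlt, hpar, P.posInv_bwd hq hm⟩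
    · simp only [PortedGraph.step, if_neg hv]
      refine ⟨Finset.mem_insert_of_mem hR, ?_, ?_, ?_⟩
      · intro x hx hxR
        by_cases hxv : x = v
        · subst hxv; simpa using hq
        · simpa [hxv] using hlt x (Finset.mem_of_mem_insert_of_ne hx hxv) hxR
      · intro x hx hxR
        by_cases hxv : x = v
        · subst hxv
          simpa using Or.inr hm
        · have := hpar x (Finset.mem_of_mem_insert_of_ne hx hxv) hxR
          simpa [hxv] using Or.inr this
      · dsimp only
        split_ifs with h
        · rw [h]
          exact P.posInv_bwd hq (Finset.mem_insert_of_mem hm)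
        · exact P.posInv_fwd (Nat.mod_lt _ (by omega)) (Finset.mem_insert_self _ _)
  | PPos.moving v q PDir.bwd, ⟨hq, hv⟩ =>
    by_cases h : v ≠ vR ∧ (q + 1) % P.deg v = par v
    · simp only [PortedGraph.step, if_pos h]
      exact ⟨hR, hlt, hpar, P.posInv_bwd (hlt v hv h.1) (hpar v hv h.1)⟩
    · by_cases h' : v = vR ∧ (q + 1) % P.deg v = 0
      · simp only [PortedGraph.step, if_neg h, if_pos h']
        exact ⟨hR, hlt, hpar, trivial⟩
      · simp only [PortedGraph.step, if_neg h, if_neg h']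
        exact ⟨hR, hlt, hpar, P.posInv_fwd (Nat.mod_lt _ (by omega)) hv⟩

theorem inv_trace (t : ℕ) : P.Inv vR (P.trace vR t) := by
  induction t with
  | zero =>
    exact ⟨by simp [trace], by simp [trace], by simp [trace], trivial⟩
  | succ t ih => exact ih.step

/-- A step that changes the visited set is an application of rule (i). -/
theorem exists_of_step_vis_ne {s : PState V} (h : (P.step vR s).vis ≠ s.vis) :
    ∃ v q, s.pos = PPos.moving v q PDir.fwd ∧ v ∉ s.vis ∧
      (P.step vR s).vis = insert v s.vis ∧
      (P.step vR s).par = Function.update s.par v q := by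
  obtain ⟨pos, vis, par⟩ := s
  match pos with
  | PPos.start => exact absurd (by simp only [step]; split_ifs <;> rfl) h
  | PPos.halted v => exact absurd rfl h
  | PPos.moving v q PDir.fwd =>
    by_cases hv : v ∈ vis
    · exact absurd (by simp only [step, if_pos hv]) h
    · exact ⟨v, q, rfl, hv, by simp only [step, if_neg hv], by simp only [step, if_neg hv]⟩
  | PPos.moving v q PDir.bwd => exact absurd (by simp only [step]; split_ifs <;> rfl) h

end PortedGraph

/-- for every `2 ≤ k ≤ n`, the `k`-stopped port-DFS traversal halts
at the vertex `v_L` (the `k`-th vertex added to `S`): at the stopping moment,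
after `stopTime - 1` moves, the walk stands at `v_L`; and `v_L` is a leaf of the
tree `T` of parent edges, i.e. `v_L` has degree `1` in `T`. -/
theorem statement4 {V : Type} [Fintype V] [DecidableEq V]
    (P : PortedGraph V) (vR : V) (k : ℕ)
    (hk1 : 2 ≤ k) (hk2 : k ≤ Fintype.card V) :
    (∃ q : ℕ, ∃ d : PDir,
      (P.trace vR (P.stopTime vR k - 1)).pos = PPos.moving (P.lastVert vR k) q d) ∧
    ((P.treeRel vR k).neighborSet (P.lastVert vR k)).ncard = 1 := by
  obtain ⟨t, ht⟩ := P.exists_trace_vis_eq_univ vR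
  have hne : {t : ℕ | k ≤ ((P.trace vR t).vis).card}.Nonempty :=
    ⟨t, by simpa [ht, Finset.card_univ] using hk2⟩
  have hmem : k ≤ (P.trace vR (P.stopTime vR k)).vis.card := Nat.sInf_mem hne
  have hmin : ∀ t < P.stopTime vR k, (P.trace vR t).vis.card < k := fun t ht =>
    not_le.1 fun h => ht.not_ge (Nat.sInf_le (s := {t | k ≤ (P.trace vR t).vis.card}) h)
  obtain ⟨T, hT⟩ : ∃ T, P.stopTime vR k = T + 1 := by
    refine Nat.exists_eq_succ_of_ne_zero fun h => ?_
    rw [h] at hmem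
    simp [PortedGraph.trace] at hmem
    omega
  have hlt := hmin T (by omega)
  have hT' : P.trace vR (P.stopTime vR k) = P.step vR (P.trace vR T) := by rw [hT]; rfl
  obtain ⟨v, q, hpos, hv, hvis, hpar⟩ :=
    P.exists_of_step_vis_ne (vR := vR) (s := P.trace vR T) fun h => by
      rw [hT', h] at hmem
      omega
  have hvisited : P.visitedBy vR k = insert v (P.trace vR T).vis := by
    rw [PortedGraph.visitedBy, hT', hvis]
  have hparent : ∀ x, P.parentVert vR k x =
      P.dest x (Function.update (P.trace vR T).par v q x) := fun x => by
    rw [PortedGraph.parentVert, PortedGraph.parFinal, hT', hpar]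
  have hlast : P.lastVert vR k = v := by
    have h : ∃ w, w ∈ P.visitedBy vR k ∧ w ∉ (P.trace vR (P.stopTime vR k - 1)).vis :=
      ⟨v, by simp [hvisited], by simpa [hT] using hv⟩
    rw [PortedGraph.lastVert, dif_pos h]
    have hs := h.choose_spec
    generalize h.choose = w at hs
    rw [hvisited, hT, Nat.add_sub_cancel, Finset.mem_insert] at hs
    exact hs.1.resolve_right hs.2
  have hinv := P.inv_trace (vR := vR) T
  have hq : q < P.deg v := by
    have := hinv.pos
    rw [hpos] at this
    exact this.1
  have hvR : v ≠ vR := by rintro rfl; exact hv hinv.root_mem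
  rw [hlast]
  refine ⟨⟨q, PDir.fwd, by rw [hT]; exact hpos⟩, Set.ncard_eq_one.2 ⟨P.dest v q, ?_⟩⟩
  ext x
  simp only [SimpleGraph.mem_neighborSet, PortedGraph.treeRel, SimpleGraph.fromRel_adj,
    Set.mem_singleton_iff, hvisited, hparent]
  constructor
  · rintro ⟨hvx, ⟨-, -, h⟩ | ⟨hx, hxR, h⟩⟩
    · simpa using h
    · rw [Function.update_of_ne hvx.symm] at h
      exact absurd (h ▸ hinv.parent_mem x (Finset.mem_of_mem_insert_of_ne hx hvx.symm) hxR) hv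
  · rintro rfl
    exact ⟨(P.adj_dest hq).ne, Or.inl ⟨Finset.mem_insert_self _ _, hvR, by simp⟩⟩
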